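/- For all real x with |x| < 1 and |4x/(1+x)^2| < 1, and parameters a, b such that 2b+1 is not zero or a negative integer, the identity (1+x)^{-2a} · ₂F₁(a, b; 2b+1; 4x/(1+x)^2) = ₂F₁(a, a-b+1/2; b+1/2; x²) − (2ax/(2b+1)) · ₂F₁(a+1, a-b+1/2; b+3/2; x²) holds. -/

import Mathlib

open scoped Nat

/-- Pochhammer symbol (rising factorial). -/
noncomputable def poch (a : ℝ) (n : ℕ) : ℝ := (ascPochhammer ℝ n).eval a

/-- Gauss hypergeometric series ₂F₁(a,b;c;z). -/
noncomputable def F (a b c z : ℝ) : ℝ :=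
  ∑' n : ℕ, poch a n * poch b n / (poch c n * (n ! : ℝ)) * z ^ n

open Filter Topology

/-- Summability of a power series on the open unit disc. -/
def RKSum (u : ℕ → ℝ) : Prop := ∀ z : ℝ, |z| < 1 → Summable fun n => u n * z ^ n

/-- Sum of a power series. -/
noncomputable def rkS (u : ℕ → ℝ) (z : ℝ) : ℝ := ∑' n, u n * z ^ n

/-- Coefficients of the derivative. -/
def rkD (u : ℕ → ℝ) (n : ℕ) : ℝ := ((n : ℝ) + 1) * u (n + 1)

lemma RKSum.bound {u : ℕ → ℝ} (hu : RKSum u) {r : ℝ} (h0 : 0 ≤ r) (h1 : r < 1) :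
    Summable fun n : ℕ => |rkD u n| * r ^ n := by
  obtain ⟨s, hrs, hs1⟩ := exists_between h1
  have hs0 : 0 < s := lt_of_le_of_lt h0 hrs
  have hs := hu s (by rw [abs_of_pos hs0]; exact hs1)
  obtain ⟨M, hM⟩ := (hs.tendsto_atTop_zero.norm).bddAbove_range
  have hM' : ∀ n, |u n| * s ^ n ≤ M := by
    intro n
    have := hM ⟨n, rfl⟩
    simpa [abs_mul, abs_of_pos hs0] using this
  have hq : ‖r / s‖ < 1 := by
    rw [Real.norm_eq_abs, abs_of_nonneg (by positivity), div_lt_one hs0]; exact hrs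
  have hg0 := summable_pow_mul_geometric_of_norm_lt_one 0 hq
  have hg1 := summable_pow_mul_geometric_of_norm_lt_one 1 hq
  have hg := ((hg1.add hg0).mul_left (M / s))
  refine Summable.of_nonneg_of_le (fun n => by positivity) (fun n => ?_) hg
  have h2 := hM' (n + 1)
  have h3 : |u (n + 1)| ≤ M / s ^ (n + 1) := by rw [le_div_iff₀ (by positivity)]; exact h2
  have : |rkD u n| * r ^ n = ((n : ℝ) + 1) * |u (n + 1)| * r ^ n := by
    rw [rkD, abs_mul, abs_of_nonneg (by positivity)]
  rw [this]
  calc ((n : ℝ) + 1) * |u (n + 1)| * r ^ n ≤ ((n : ℝ) + 1) * (M / s ^ (n + 1)) * r ^ n := by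
        gcongr
    _ = _ := by rw [div_pow, pow_succ]; field_simp

lemma RKSum.deriv {u : ℕ → ℝ} (hu : RKSum u) : RKSum (rkD u) := by
  intro z hz
  refine Summable.of_norm ?_
  simpa [abs_mul] using hu.bound (abs_nonneg z) hz

lemma RKSum.hasDerivAt {u : ℕ → ℝ} (hu : RKSum u) {z : ℝ} (hz : |z| < 1) :
    HasDerivAt (rkS u) (rkS (rkD u) z) z := by
  obtain ⟨s, hzs, hs1⟩ := exists_between hz
  have hs0 : 0 < s := lt_of_le_of_lt (abs_nonneg z) hzs
  have hb := hu.bound hs0.le hs1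
  have key := hasDerivAt_tsum_of_isPreconnected (𝕜 := ℝ) (F := ℝ)
    (u := fun n : ℕ => |rkD u n| * s ^ n)
    (g := fun n y => u (n + 1) * y ^ (n + 1))
    (g' := fun n y => rkD u n * y ^ n)
    (t := Metric.ball (0 : ℝ) s) (y₀ := 0) (y := z) hb Metric.isOpen_ball
    (convex_ball (0 : ℝ) s).isPreconnected ?_ ?_ (Metric.mem_ball_self hs0) (by simp)
    (by simpa using hzs)
  · have h2 : rkS u =ᶠ[𝓝 z] fun y => u 0 + ∑' n, u (n + 1) * y ^ (n + 1) := by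
      have : ∀ᶠ y : ℝ in 𝓝 z, |y| < 1 := continuous_abs.continuousAt.eventually_lt_const hz
      filter_upwards [this] with y hy
      rw [rkS, (hu y hy).tsum_eq_zero_add]; simp
    exact (key.const_add (u 0)).congr_of_eventuallyEq h2
  · intro n y _
    have := (hasDerivAt_pow (n + 1) y).const_mul (u (n + 1))
    refine this.congr_deriv ?_
    simp only [rkD, Nat.add_sub_cancel]; push_cast; ring
  · intro n y hy
    have hy' : |y| ≤ s := by simpa using (Metric.mem_ball.1 hy).le
    rw [norm_mul, norm_pow, Real.norm_eq_abs, Real.norm_eq_abs]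
    gcongr

lemma RKSum.analyticAt {u : ℕ → ℝ} (hu : RKSum u) {z : ℝ} (hz : |z| < 1) :
    AnalyticAt ℝ (rkS u) z := by
  have hr : (1 : ENNReal) ≤ (FormalMultilinearSeries.ofScalars ℝ u).radius := by
    refine ENNReal.le_of_forall_nnreal_lt fun r hr => ?_
    apply FormalMultilinearSeries.le_radius_of_summable_norm
    simp only [FormalMultilinearSeries.ofScalars_norm]
    have hr1 : (r : ℝ) < 1 := by exact_mod_cast hr
    have := (hu r (by rw [abs_of_nonneg r.coe_nonneg]; exact hr1)).norm
    simpa using this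
  have hp := (FormalMultilinearSeries.ofScalars ℝ u).hasFPowerSeriesOnBall
    (lt_of_lt_of_le zero_lt_one hr)
  have he : (FormalMultilinearSeries.ofScalars ℝ u).sum = rkS u := by
    funext x
    rw [FormalMultilinearSeries.sum, rkS]
    simp [mul_comm]
  rw [he] at hp
  apply hp.analyticAt_of_mem
  refine Metric.eball_subset_eball hr ?_
  rw [Metric.mem_eball, edist_dist, Real.dist_eq, sub_zero]
  rw [ENNReal.ofReal_lt_one]; exact hz

lemma RKSum.hasSum {u : ℕ → ℝ} (hu : RKSum u) {z : ℝ} (hz : |z| < 1) :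
    HasSum (fun n => u n * z ^ n) (rkS u z) := (hu z hz).hasSum

lemma RKSum.hasSum1 {u : ℕ → ℝ} (hu : RKSum u) {z : ℝ} (hz : |z| < 1) :
    HasSum (fun n : ℕ => (n : ℝ) * u n * z ^ n) (z * rkS (rkD u) z) := by
  have h := (hu.deriv.hasSum hz).mul_left z
  have := (hasSum_nat_add_iff' (f := fun n : ℕ => (n : ℝ) * u n * z ^ n)
    (g := z * rkS (rkD u) z) 1).1
  apply this
  simp only [Finset.range_one, Finset.sum_singleton, Nat.cast_zero, zero_mul, sub_zero]
  refine h.congr_fun fun n => ?_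
  simp only [rkD]; push_cast; ring

lemma RKSum.hasSum2 {u : ℕ → ℝ} (hu : RKSum u) {z : ℝ} (hz : |z| < 1) :
    HasSum (fun n : ℕ => (n : ℝ) * ((n : ℝ) - 1) * u n * z ^ n)
      (z ^ 2 * rkS (rkD (rkD u)) z) := by
  have h := (hu.deriv.deriv.hasSum hz).mul_left (z ^ 2)
  have := (hasSum_nat_add_iff' (f := fun n : ℕ => (n : ℝ) * ((n : ℝ) - 1) * u n * z ^ n)
    (g := z ^ 2 * rkS (rkD (rkD u)) z) 2).1
  apply this
  have e : ∑ n ∈ Finset.range 2, (n : ℝ) * ((n : ℝ) - 1) * u n * z ^ n = 0 := by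
    simp [Finset.sum_range_succ]
  rw [e, sub_zero]
  refine h.congr_fun fun n => ?_
  simp only [rkD]; push_cast; ring

/-- Hypergeometric coefficients. -/
noncomputable def rkH (a b c : ℝ) (n : ℕ) : ℝ := poch a n * poch b n / (poch c n * (n ! : ℝ))

lemma poch_succ (a : ℝ) (n : ℕ) : poch a (n + 1) = poch a n * (a + n) := by
  rw [poch, poch, ascPochhammer_succ_eval]

lemma poch_zero (a : ℝ) : poch a 0 = 1 := by simp [poch]

lemma rkH_succ (a b c : ℝ) (n : ℕ) :
    rkH a b c (n + 1) = rkH a b c n * ((a + n) / (c + n) * ((b + n) / (1 + n))) := by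
  simp only [rkH, poch_succ, Nat.factorial_succ]
  push_cast
  rw [div_mul_div_comm, div_mul_div_comm]
  congr 1 <;> ring

lemma rkH_sum (a b c : ℝ) : RKSum (rkH a b c) := by
  intro z hz
  obtain ⟨r, hr, hr1⟩ := exists_between hz
  refine summable_of_ratio_norm_eventually_le hr1 ?_
  have t : Tendsto (fun n : ℕ => |((a + n) / (c + n) * ((b + n) / (1 + n))) * z|) atTop
      (𝓝 |(1 * 1) * z|) := by
    refine Tendsto.abs (Tendsto.mul_const _ (Tendsto.mul ?_ ?_))
    · simpa using tendsto_add_mul_div_add_mul_atTop_nhds a c (1 : ℝ) (one_ne_zero (α := ℝ))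
    · simpa using tendsto_add_mul_div_add_mul_atTop_nhds b 1 (1 : ℝ) (one_ne_zero (α := ℝ))
  have hz' : |(1 * 1) * z| < r := by simpa using hr
  filter_upwards [t.eventually_lt_const hz'] with n hn
  rw [rkH_succ, pow_succ]
  have : rkH a b c n * ((a + n) / (c + n) * ((b + n) / (1 + n))) * (z ^ n * z) =
    (((a + n) / (c + n) * ((b + n) / (1 + n))) * z) * (rkH a b c n * z ^ n) := by ring
  rw [this, norm_mul]
  gcongr
  exact hn.le

/-- Hypergeometric differential equation. -/
lemma rkH_ode (a b c : ℝ) (hc : ∀ k : ℕ, c + k ≠ 0) {z : ℝ} (hz : |z| < 1) :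
    z * (1 - z) * rkS (rkD (rkD (rkH a b c))) z
      + (c - (a + b + 1) * z) * rkS (rkD (rkH a b c)) z - a * b * rkS (rkH a b c) z = 0 := by
  have hu := rkH_sum a b c
  have h0 := hu.hasSum hz
  have h1 := hu.hasSum1 hz
  have h2 := hu.hasSum2 hz
  have d0 := hu.deriv.hasSum hz
  have d1 := hu.deriv.hasSum1 hz
  have H := ((((d1.sub h2).add (d0.mul_left c)).sub (h1.mul_left (a + b + 1))).sub
    (h0.mul_left (a * b)))
  have Z : HasSum (fun _ : ℕ => (0 : ℝ)) 0 := hasSum_zero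
  have E := H.unique (Z.congr_fun ?_)
  · linear_combination E
  · intro n
    have hr : (c + n) * (1 + n) * rkH a b c (n + 1) = (a + n) * (b + n) * rkH a b c n := by
      rw [rkH_succ]
      have := hc n
      have : (1 : ℝ) + n ≠ 0 := by positivity
      field_simp
    simp only [rkD]
    linear_combination z ^ n * hr

/-- Uniqueness of analytic solutions. -/
lemma rk_unique (a b : ℝ) (hb : ∀ k : ℕ, 2 * b + 1 + (k : ℝ) ≠ 0) (h : ℝ → ℝ)
    (ha : AnalyticAt ℝ h 0) (h0 : h 0 = 0)
    (ode : ∀ᶠ x in 𝓝 (0 : ℝ), x ^ 2 * (x ^ 2 - 1) * deriv (deriv h) x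
      + x * ((1 + 4 * a - 2 * b) * x ^ 2 - 2 * x - (1 + 2 * b)) * deriv h x
      + (4 * a * (a - b) * x ^ 2 - 2 * a * x) * h x = 0) :
    ∀ᶠ x in 𝓝 (0 : ℝ), h x = 0 := by
  by_contra hne
  obtain ⟨n, u, hu, hu0, hhu⟩ := ha.exists_eventuallyEq_pow_smul_nonzero_iff.2 hne
  simp only [sub_zero, smul_eq_mul] at hhu
  obtain _ | m := n
  · have := hhu.self_of_nhds
    rw [h0] at this
    simp at this
    exact hu0 this.symm
  have hu1 := hu.deriv
  have hu2 := hu1.deriv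
  have e0 : h =ᶠ[𝓝 0] fun x => x ^ (m + 1) * u x := hhu
  have e1 : deriv h =ᶠ[𝓝 0] fun x => ((m : ℝ) + 1) * x ^ m * u x + x ^ (m + 1) * deriv u x := by
    refine e0.deriv.trans ?_
    filter_upwards [hu.eventually_analyticAt] with x hx
    have := (hasDerivAt_pow (m + 1) x).mul hx.differentiableAt.hasDerivAt
    have h3 := this.deriv
    simp only [Nat.add_sub_cancel] at h3
    push_cast at h3
    exact h3
  have e2 : deriv (deriv h) =ᶠ[𝓝 0] fun x =>
      (((m : ℝ) + 1) * (m * x ^ (m - 1))) * u x + ((m : ℝ) + 1) * x ^ m * deriv u x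
      + (((m : ℝ) + 1) * x ^ m * deriv u x + x ^ (m + 1) * deriv (deriv u) x) := by
    refine e1.deriv.trans ?_
    filter_upwards [hu.eventually_analyticAt, hu1.eventually_analyticAt] with x hx hx1
    have A := ((hasDerivAt_pow m x).const_mul ((m : ℝ) + 1)).mul hx.differentiableAt.hasDerivAt
    have B := (hasDerivAt_pow (m + 1) x).mul hx1.differentiableAt.hasDerivAt
    have h3 := (A.add B).deriv
    simp only [Nat.add_sub_cancel] at h3
    push_cast at h3
    exact h3
  let Φ : ℝ → ℝ := fun x => (x ^ 2 - 1) * (((m : ℝ) + 1) * m * u x + 2 * ((m : ℝ) + 1) * x * deriv u x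
      + x ^ 2 * deriv (deriv u) x)
    + ((1 + 4 * a - 2 * b) * x ^ 2 - 2 * x - (1 + 2 * b)) * (((m : ℝ) + 1) * u x + x * deriv u x)
    + (4 * a * (a - b) * x ^ 2 - 2 * a * x) * u x
  have hΦc : ContinuousAt Φ 0 := by
    have c0 := hu.continuousAt
    have c1 := hu1.continuousAt
    have c2 := hu2.continuousAt
    fun_prop
  have hΦ : ∀ᶠ x in 𝓝[≠] (0 : ℝ), Φ x = 0 := by
    have hall := ode.and (hhu.and (e1.and e2))
    filter_upwards [hall.filter_mono nhdsWithin_le_nhds, self_mem_nhdsWithin] with x hx hx0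
    obtain ⟨o, q0, q1, q2⟩ := hx
    have hx0 : x ≠ 0 := hx0
    rw [q0, q1, q2] at o
    have hm : (m : ℝ) * x ^ (m - 1) * x = m * x ^ m := by
      rcases m with _ | m
      · simp
      · simp [pow_succ]; ring
    have : x ^ (m + 1) * Φ x = 0 := by
      simp only [Φ]
      linear_combination o - x * (x ^ 2 - 1) * (m + 1) * u x * hm
    exact (mul_eq_zero.1 this).resolve_left (pow_ne_zero _ hx0)
  have lim : Tendsto Φ (𝓝[≠] 0) (𝓝 0) :=
    tendsto_const_nhds.congr' (hΦ.mono fun x hx => hx.symm)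
  have hz : Φ 0 = 0 := tendsto_nhds_unique (hΦc.tendsto.mono_left nhdsWithin_le_nhds) lim
  have hz2 : ((m : ℝ) + 1) * (2 * b + 1 + m) * u 0 = 0 := by
    simp only [Φ] at hz
    linear_combination -hz
  have : (m : ℝ) + 1 ≠ 0 := by positivity
  simp [this, hb m, hu0] at hz2

/-- Coefficients of the right-hand side. -/
noncomputable def rkG (a b : ℝ) (n : ℕ) : ℝ :=
  if Even n then rkH a (a - b + 1/2) (b + 1/2) (n / 2)
  else -(2 * a / (2 * b + 1)) * rkH (a + 1) (a - b + 1/2) (b + 3/2) (n / 2)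

lemma rkG_even (a b : ℝ) (k : ℕ) : rkG a b (2 * k) = rkH a (a - b + 1/2) (b + 1/2) k := by
  simp [rkG]

lemma rkG_odd (a b : ℝ) (k : ℕ) :
    rkG a b (2 * k + 1) = -(2 * a / (2 * b + 1)) * rkH (a + 1) (a - b + 1/2) (b + 3/2) k := by
  have : (2 * k + 1) / 2 = k := by omega
  simp [rkG, this]

lemma rkG_hasSum (a b : ℝ) {x : ℝ} (hx : |x| < 1) :
    HasSum (fun n => rkG a b n * x ^ n)
      (F a (a - b + 1/2) (b + 1/2) (x ^ 2)
        - (2 * a * x / (2 * b + 1)) * F (a + 1) (a - b + 1/2) (b + 3/2) (x ^ 2)) := by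
  have hx2 : |x ^ 2| < 1 := by
    rw [abs_pow]; exact pow_lt_one₀ (abs_nonneg _) hx two_ne_zero
  have A := (rkH_sum a (a - b + 1/2) (b + 1/2)).hasSum hx2
  have B := ((rkH_sum (a + 1) (a - b + 1/2) (b + 3/2)).hasSum hx2).mul_left
    (-(2 * a / (2 * b + 1)) * x)
  have := HasSum.even_add_odd (f := fun n => rkG a b n * x ^ n)
    (A.congr_fun (fun k => by rw [rkG_even, pow_mul]))
    (B.congr_fun (fun k => by rw [rkG_odd, pow_succ, pow_mul]; ring))
  convert this using 1
  simp only [F, rkS, rkH]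
  ring

lemma rkG_sum (a b : ℝ) : RKSum (rkG a b) := fun _ hz => (rkG_hasSum a b hz).summable

lemma rkG_step (a b : ℝ) (hb : ∀ k : ℕ, 2 * b + 1 + (k : ℝ) ≠ 0) (k : ℕ) :
    (2 * b + 1 + 2 * k) * rkG a b (2 * k + 1) = -(2 * (a + k)) * rkG a b (2 * k) := by
  rw [rkG_odd, rkG_even]
  have hb0 := hb 0
  simp only [Nat.cast_zero, add_zero] at hb0
  induction k with
  | zero => simp [rkH, poch_zero]; field_simp
  | succ k ih =>
    rw [rkH_succ, rkH_succ]
    have h1 : b + 1/2 + (k : ℝ) ≠ 0 := by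
      have := hb (2 * k); push_cast at this; intro h; apply this; linarith
    have h2 : b + 3/2 + (k : ℝ) ≠ 0 := by
      have := hb (2 * k + 2); push_cast at this; intro h; apply this; linarith
    have h3 : (1 : ℝ) + k ≠ 0 := by positivity
    generalize rkH a (a - b + 1/2) (b + 1/2) k = P at *
    generalize rkH (a + 1) (a - b + 1/2) (b + 3/2) k = Q at *
    have h4 : 2 * b + 1 + 2 * (k : ℝ) ≠ 0 := by
      have := hb (2 * k); push_cast at this; exact this
    have e1 : -(2 * a / (2 * b + 1)) * Q = -(2 * (a + k)) * P / (2 * b + 1 + 2 * k) := by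
      rw [eq_div_iff h4, ← ih]; ring
    have e2 : b + 1/2 + (k : ℝ) = (2 * b + 1 + 2 * k) / 2 := by ring
    rw [← mul_assoc (-(2 * a / (2 * b + 1))), e1, e2]
    push_cast
    have e3 : 2 * b + 1 + 2 * ((k : ℝ) + 1) = 2 * (b + 3/2 + k) := by ring
    rw [e3]
    generalize b + 3/2 + (k : ℝ) = t at *
    generalize 2 * b + 1 + 2 * (k : ℝ) = v at *
    field_simp
    ring

lemma rkG_step2 (a b : ℝ) (hb : ∀ k : ℕ, 2 * b + 1 + (k : ℝ) ≠ 0) (k : ℕ) :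
    2 * ((k : ℝ) + 1) * rkG a b (2 * k + 2)
      = -(2 * (a - b + 1/2 + k)) * rkG a b (2 * k + 1) := by
  have h := rkG_step a b hb k
  have h4 : 2 * b + 1 + 2 * (k : ℝ) ≠ 0 := by
    have := hb (2 * k); push_cast at this; exact this
  have e1 : rkG a b (2 * k + 1) = -(2 * (a + k)) * rkG a b (2 * k) / (2 * b + 1 + 2 * k) := by
    rw [eq_div_iff h4, ← h]; ring
  rw [e1, show 2 * k + 2 = 2 * (k + 1) by ring, rkG_even, rkG_even, rkH_succ]
  have e2 : b + 1/2 + (k : ℝ) = (2 * b + 1 + 2 * k) / 2 := by ring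
  rw [e2]
  have h3 : (1 : ℝ) + k ≠ 0 := by positivity
  generalize 2 * b + 1 + 2 * (k : ℝ) = v at *
  field_simp
  ring

lemma rkG_rec (a b : ℝ) (hb : ∀ k : ℕ, 2 * b + 1 + (k : ℝ) ≠ 0) (n : ℕ) :
    ((n : ℝ) + 2) * (n + 2 + 2 * b) * rkG a b (n + 2) + 2 * (n + 1 + a) * rkG a b (n + 1)
      - (n + 2 * a) * (n + 2 * a - 2 * b) * rkG a b n = 0 := by
  rcases Nat.even_or_odd' n with ⟨k, rfl | rfl⟩
  · have s1 := rkG_step a b hb k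
    have s2 := rkG_step2 a b hb k
    push_cast
    linear_combination (2 * (k : ℝ) + 2 + 2 * b) * s2 - (2 * (k : ℝ) + 2 * a - 2 * b) * s1
  · have s1 := rkG_step a b hb (k + 1)
    have s2 := rkG_step2 a b hb k
    rw [show 2 * (k + 1) + 1 = 2 * k + 1 + 2 by ring, show 2 * (k + 1) = 2 * k + 1 + 1 by ring]
      at s1
    rw [show 2 * k + 2 = 2 * k + 1 + 1 by ring] at s2
    push_cast at s1 ⊢
    linear_combination (2 * (k : ℝ) + 3) * s1 - (2 * (k : ℝ) + 1 + 2 * a) * s2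

lemma rkG_ode (a b : ℝ) (hb : ∀ k : ℕ, 2 * b + 1 + (k : ℝ) ≠ 0) {x : ℝ} (hx : |x| < 1) :
    x ^ 2 * (x ^ 2 - 1) * rkS (rkD (rkD (rkG a b))) x
      + x * ((1 + 4 * a - 2 * b) * x ^ 2 - 2 * x - (1 + 2 * b)) * rkS (rkD (rkG a b)) x
      + (4 * a * (a - b) * x ^ 2 - 2 * a * x) * rkS (rkG a b) x = 0 := by
  have hu := rkG_sum a b
  have h0 := hu.hasSum hx
  have h1 := hu.hasSum1 hx
  have h2 := hu.hasSum2 hx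
  have A := (h2.add (h1.mul_left (1 + 4 * a - 2 * b))).add (h0.mul_left (4 * a * (a - b)))
  have B := (h1.mul_left 2).add (h0.mul_left (2 * a))
  have C := h2.add (h1.mul_left (1 + 2 * b))
  have B' := ((hasSum_nat_add_iff' 1).2 B).mul_left x
  have C' := (hasSum_nat_add_iff' 2).2 C
  have H := ((A.mul_left (x ^ 2)).sub B').sub C'
  have Z : HasSum (fun _ : ℕ => (0 : ℝ)) 0 := hasSum_zero
  have E := H.unique (Z.congr_fun ?_)
  · simp only [Finset.sum_range_succ, Finset.range_zero, Finset.sum_empty] at E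
    have s := rkG_step a b hb 0
    simp only [Nat.cast_zero, Nat.cast_one, mul_zero, zero_add, add_zero] at E s
    linear_combination E - x * s
  · intro n
    have hr := rkG_rec a b hb n
    push_cast
    linear_combination -x ^ (n + 2) * hr

/-- Derivatives of the left-hand side. -/
lemma rkL_deriv (a x : ℝ) (y y' : ℝ → ℝ) (hs : 0 < 1 + x)
    (hy : HasDerivAt y (y' (4 * x / (1 + x) ^ 2)) (4 * x / (1 + x) ^ 2)) :
    HasDerivAt (fun x : ℝ => (1 + x) ^ (-(2 * a)) * y (4 * x / (1 + x) ^ 2))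
      ((1 + x) ^ (-(2 * a)) * (4 * (1 - x) / (1 + x) ^ 3 * y' (4 * x / (1 + x) ^ 2)
        - 2 * a / (1 + x) * y (4 * x / (1 + x) ^ 2))) x := by
  have hs' := hs.ne'
  have h1 : HasDerivAt (fun x : ℝ => 1 + x) 1 x := (hasDerivAt_id x).const_add 1
  have hE := h1.rpow_const (p := -(2 * a)) (Or.inl hs')
  have hz : HasDerivAt (fun x : ℝ => 4 * x / (1 + x) ^ 2) (4 * (1 - x) / (1 + x) ^ 3) x := by
    have := ((hasDerivAt_id x).const_mul 4).div (h1.pow 2) (pow_ne_zero 2 hs')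
    refine this.congr_deriv ?_
    simp
    field_simp
    ring
  have := hE.mul (hy.comp x hz)
  refine this.congr_deriv ?_
  rw [Real.rpow_sub_one hs']
  simp only [Function.comp]
  ring

lemma rkL_deriv2 (a x : ℝ) (y y' y'' : ℝ → ℝ) (hs : 0 < 1 + x)
    (hy : HasDerivAt y (y' (4 * x / (1 + x) ^ 2)) (4 * x / (1 + x) ^ 2))
    (hy' : HasDerivAt y' (y'' (4 * x / (1 + x) ^ 2)) (4 * x / (1 + x) ^ 2)) :
    HasDerivAt (fun x : ℝ => (1 + x) ^ (-(2 * a)) *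
      (4 * (1 - x) / (1 + x) ^ 3 * y' (4 * x / (1 + x) ^ 2)
        - 2 * a / (1 + x) * y (4 * x / (1 + x) ^ 2)))
      ((1 + x) ^ (-(2 * a)) * (16 * (1 - x) ^ 2 / (1 + x) ^ 6 * y'' (4 * x / (1 + x) ^ 2)
        + ((8 * x - 16) / (1 + x) ^ 4 - 16 * a * (1 - x) / (1 + x) ^ 4) * y' (4 * x / (1 + x) ^ 2)
        + 2 * a * (2 * a + 1) / (1 + x) ^ 2 * y (4 * x / (1 + x) ^ 2))) x := by
  have hs' := hs.ne'
  have h1 : HasDerivAt (fun x : ℝ => 1 + x) 1 x := (hasDerivAt_id x).const_add 1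
  have A := rkL_deriv a x y y' hs hy
  have B := rkL_deriv a x y' y'' hs hy'
  have hp : HasDerivAt (fun x : ℝ => 4 * (1 - x) / (1 + x) ^ 3)
      ((8 * x - 16) / (1 + x) ^ 4) x := by
    have := (((hasDerivAt_id x).const_sub 1).const_mul 4).div (h1.pow 3) (pow_ne_zero 3 hs')
    refine this.congr_deriv ?_
    simp
    field_simp
    ring
  have hq : HasDerivAt (fun x : ℝ => 2 * a / (1 + x)) (-(2 * a) / (1 + x) ^ 2) x := by
    have := (hasDerivAt_const x (2 * a)).div h1 hs'
    refine this.congr_deriv ?_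
    simp
  have := (hp.mul B).sub (hq.mul A)
  refine (this.congr_deriv ?_).congr_of_eventuallyEq (Eventually.of_forall fun t => ?_)
  rotate_left
  · simp only [Pi.mul_apply, Pi.sub_apply]
    ring
  · field_simp
    ring

lemma rk_region {x : ℝ} (hx : |x| < 1) : 0 < 1 + x := by
  have := (abs_lt.1 hx).1; linarith

/-- The region of validity in explicit form. -/
lemma rk_region_iff {x : ℝ} (hs : 0 < 1 + x) :
    |4 * x / (1 + x) ^ 2| < 1 ↔ x ≠ 1 ∧ -(3 - 2 * √2) < x := by
  have h2 : √2 ^ 2 = 2 := Real.sq_sqrt (by norm_num)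
  have h2p : 1 < √2 := by
    rw [Real.lt_sqrt] <;> norm_num
  have hp : 0 < (1 + x) ^ 2 := by positivity
  rw [abs_lt, div_lt_one hp, lt_div_iff₀ hp]
  constructor
  · rintro ⟨h, h'⟩
    refine ⟨fun h => by subst h; norm_num at h', ?_⟩
    by_contra hc
    push Not at hc
    have : x + 3 + 2 * √2 > 0 := by linarith
    nlinarith
  · rintro ⟨h, h'⟩
    have h3 : 0 < (1 - x) ^ 2 := by
      have : 1 - x ≠ 0 := fun h'' => h (by linarith)
      positivity
    constructor
    · nlinarith [mul_pos (show 0 < x + 3 - 2 * √2 by linarith)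
        (show 0 < x + 3 + 2 * √2 by linarith)]
    · nlinarith

/-- The left-hand side. -/
noncomputable def rkL (a b x : ℝ) : ℝ :=
  (1 + x) ^ (-(2 * a)) * rkS (rkH a b (2 * b + 1)) (4 * x / (1 + x) ^ 2)

lemma rkL_analyticAt (a b : ℝ) {x : ℝ} (hs : 0 < 1 + x) (hz : |4 * x / (1 + x) ^ 2| < 1) :
    AnalyticAt ℝ (rkL a b) x := by
  have h1 : AnalyticAt ℝ (fun x : ℝ => 1 + x) x := by fun_prop
  have hz' : AnalyticAt ℝ (fun x : ℝ => 4 * x / (1 + x) ^ 2) x :=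
    AnalyticAt.div (by fun_prop) (by fun_prop) (pow_ne_zero 2 hs.ne')
  have hE : AnalyticAt ℝ (fun x : ℝ => (1 + x) ^ (-(2 * a))) x := by
    have e : (fun x : ℝ => (1 + x) ^ (-(2 * a))) =ᶠ[𝓝 x]
        fun x => Real.exp (Real.log (1 + x) * (-(2 * a))) := by
      have : ∀ᶠ t : ℝ in 𝓝 x, 0 < 1 + t := h1.continuousAt.eventually_const_lt hs
      filter_upwards [this] with t ht
      rw [Real.rpow_def_of_pos ht]
    refine AnalyticAt.congr ?_ e.symm
    exact ((h1.log hs).mul analyticAt_const).rexp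
  have hy := (rkH_sum a b (2 * b + 1)).analyticAt hz
  exact hE.mul (AnalyticAt.fun_comp (f := fun x : ℝ => 4 * x / (1 + x) ^ 2) hy hz')

lemma rk_near (a b : ℝ) (hb : ∀ k : ℕ, 2 * b + 1 + (k : ℝ) ≠ 0) :
    ∀ᶠ x in 𝓝 (0 : ℝ), rkL a b x - rkS (rkG a b) x = 0 := by
  have hu := rkH_sum a b (2 * b + 1)
  have hg := rkG_sum a b
  have ev : ∀ᶠ x in 𝓝 (0 : ℝ), |x| < 1 ∧ |4 * x / (1 + x) ^ 2| < 1 := by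
    have c1 : ContinuousAt (fun x : ℝ => |x|) 0 := by fun_prop
    have c2 : ContinuousAt (fun x : ℝ => |4 * x / (1 + x) ^ 2|) 0 := by
      have : ContinuousAt (fun x : ℝ => 4 * x / (1 + x) ^ 2) 0 :=
        ContinuousAt.div (by fun_prop) (by fun_prop) (by norm_num)
      exact this.abs
    exact (c1.eventually_lt_const (by simp)).and (c2.eventually_lt_const (by simp))
  let L1 : ℝ → ℝ := fun x => (1 + x) ^ (-(2 * a)) *
      (4 * (1 - x) / (1 + x) ^ 3 * rkS (rkD (rkH a b (2 * b + 1))) (4 * x / (1 + x) ^ 2)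
        - 2 * a / (1 + x) * rkS (rkH a b (2 * b + 1)) (4 * x / (1 + x) ^ 2))
  have d1 : deriv (fun x => rkL a b x - rkS (rkG a b) x) =ᶠ[𝓝 0]
      fun x => L1 x - rkS (rkD (rkG a b)) x := by
    filter_upwards [ev] with x hx
    exact ((rkL_deriv a x _ (rkS (rkD (rkH a b (2 * b + 1)))) (rk_region hx.1)
      (hu.hasDerivAt hx.2)).sub (hg.hasDerivAt hx.1)).deriv
  apply rk_unique a b hb (fun x => rkL a b x - rkS (rkG a b) x)
  · exact (rkL_analyticAt a b (by norm_num) (by norm_num)).sub (hg.analyticAt (by norm_num))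
  · have e1 : ∀ u : ℕ → ℝ, rkS u 0 = u 0 := by
      intro u
      rw [rkS, tsum_eq_single 0]
      · simp
      · intro n hn; simp [hn]
    have e2 : rkG a b 0 = 1 := by
      have := rkG_even a b 0
      simpa [rkH, poch_zero] using this
    simp [rkL, e1, e2, rkH, poch_zero]
  · filter_upwards [ev, d1, d1.deriv] with x hx q1 q2
    have hs := rk_region hx.1
    have q3 := ((rkL_deriv2 a x _ _ (rkS (rkD (rkD (rkH a b (2 * b + 1))))) hs
      (hu.hasDerivAt hx.2) (hu.deriv.hasDerivAt hx.2)).sub (hg.deriv.hasDerivAt hx.1)).deriv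
    have q4 := q2.trans q3
    rw [q4, q1]
    have og := rkG_ode a b hb hx.1
    have oh := rkH_ode a b (2 * b + 1) hb hx.2
    simp only [L1, rkL]
    generalize rkS (rkD (rkD (rkH a b (2 * b + 1)))) (4 * x / (1 + x) ^ 2) = y2 at *
    generalize rkS (rkD (rkH a b (2 * b + 1))) (4 * x / (1 + x) ^ 2) = y1 at *
    generalize rkS (rkH a b (2 * b + 1)) (4 * x / (1 + x) ^ 2) = y0 at *
    generalize (1 + x) ^ (-(2 * a)) = E at *
    have hs' := hs.ne'
    have main : x ^ 2 * (x ^ 2 - 1) * (16 * (1 - x) ^ 2 / (1 + x) ^ 6 * y2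
        + ((8 * x - 16) / (1 + x) ^ 4 - 16 * a * (1 - x) / (1 + x) ^ 4) * y1
        + 2 * a * (2 * a + 1) / (1 + x) ^ 2 * y0)
      + x * ((1 + 4 * a - 2 * b) * x ^ 2 - 2 * x - (1 + 2 * b)) *
        (4 * (1 - x) / (1 + x) ^ 3 * y1 - 2 * a / (1 + x) * y0)
      + (4 * a * (a - b) * x ^ 2 - 2 * a * x) * y0 =
      4 * x * (x - 1) / (1 + x) * (4 * x / (1 + x) ^ 2 * (1 - 4 * x / (1 + x) ^ 2) * y2
        + (2 * b + 1 - (a + b + 1) * (4 * x / (1 + x) ^ 2)) * y1 - a * b * y0) := by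
      field_simp
      ring
    rw [oh, mul_zero] at main
    linear_combination E * main - og

theorem rathie_kim_first (a b : ℝ) (hb : ∀ k : ℕ, 2 * b + 1 + (k : ℝ) ≠ 0)
    (x : ℝ) (hx : |x| < 1) (hx2 : |4 * x / (1 + x) ^ 2| < 1) :
    (1 + x) ^ (-(2 * a)) * F a b (2 * b + 1) (4 * x / (1 + x) ^ 2) =
      F a (a - b + 1/2) (b + 1/2) (x ^ 2)
        - (2 * a * x / (2 * b + 1)) * F (a + 1) (a - b + 1/2) (b + 3/2) (x ^ 2) := by
  have h2 : √2 ^ 2 = 2 := Real.sq_sqrt (by norm_num)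
  have h2p : 1 < √2 := by
    rw [Real.lt_sqrt] <;> norm_num
  have h2q : √2 < 3 / 2 := by
    rw [Real.sqrt_lt] <;> norm_num
  have mem : ∀ t ∈ Set.Ioo (-(3 - 2 * √2)) 1, |t| < 1 ∧ |4 * t / (1 + t) ^ 2| < 1 := by
    intro t ht
    have h1 : |t| < 1 := abs_lt.2 ⟨by linarith [ht.1], ht.2⟩
    exact ⟨h1, (rk_region_iff (rk_region h1)).2 ⟨ht.2.ne, ht.1⟩⟩
  have key : Set.EqOn (rkL a b) (rkS (rkG a b)) (Set.Ioo (-(3 - 2 * √2)) 1) := by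
    refine AnalyticOnNhd.eqOn_of_preconnected_of_eventuallyEq (𝕜 := ℝ) (z₀ := 0) ?_ ?_
      isPreconnected_Ioo ⟨by linarith, by norm_num⟩ ?_
    · intro t ht
      exact rkL_analyticAt a b (rk_region (mem t ht).1) (mem t ht).2
    · intro t ht
      exact (rkG_sum a b).analyticAt (mem t ht).1
    · filter_upwards [rk_near a b hb] with t ht
      exact sub_eq_zero.1 ht
  have hxm : x ∈ Set.Ioo (-(3 - 2 * √2)) 1 :=
    ⟨((rk_region_iff (rk_region hx)).1 hx2).2, (abs_lt.1 hx).2⟩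
  rw [← (rkG_hasSum a b hx).tsum_eq]
  exact key hxm
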